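/- Fix nonempty finite sets Ω and A, a finite message set M with |M| > max{|Ω|, |A|}, and an interior prior μ₀ on Ω. Then there is a generic set of environments on which the following three statements are equivalent: (1) commitment is valuable; (2) committed Sender values randomization; (3) for every optimal persuasion profile (σ, ρ) there exists an on-path message m ∈ M_σ such that the set argmax_{a ∈ A} Σ_ω μ_m(ω) u_R(a, ω) has at least two elements, where μ_m(ω) = μ₀(ω) σ(m|ω) / Σ_{ω'} μ₀(ω') σ(m|ω'). -/

import Mathlib

open MeasureTheory

namespace KL

/-- `f` is a probability distribution on the finite type `X`. -/
def IsDist {X : Type} [Fintype X] (f : X → ℝ) : Prop :=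
  (∀ x, 0 ≤ f x) ∧ ∑ x, f x = 1

/-- `μ₀` is an interior prior on `Ω`. -/
def IsPrior {Ω : Type} [Fintype Ω] (μ₀ : Ω → ℝ) : Prop :=
  (∀ ω, 0 < μ₀ ω) ∧ ∑ ω, μ₀ ω = 1

variable {Ω A M : Type} [Fintype Ω] [Fintype A] [Fintype M]

/-- A messaging strategy: a distribution over messages in each state. -/
def IsMsg (σ : Ω → M → ℝ) : Prop := ∀ ω, IsDist (σ ω)

/-- An action strategy: a distribution over actions after each message. -/
def IsAct (ρ : M → A → ℝ) : Prop := ∀ m, IsDist (ρ m)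

/-- Expected payoff of a profile `(σ, ρ)` for utility `u`. -/
def U (μ₀ : Ω → ℝ) (u : A × Ω → ℝ) (σ : Ω → M → ℝ) (ρ : M → A → ℝ) : ℝ :=
  ∑ ω, ∑ m, ∑ a, μ₀ ω * σ ω m * ρ m a * u (a, ω)

/-- Sender best response. -/
def SBR (μ₀ : Ω → ℝ) (uS : A × Ω → ℝ) (σ : Ω → M → ℝ) (ρ : M → A → ℝ) : Prop :=
  ∀ σ' : Ω → M → ℝ, IsMsg σ' → U μ₀ uS σ' ρ ≤ U μ₀ uS σ ρ

/-- Receiver best response. -/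
def RBR (μ₀ : Ω → ℝ) (uR : A × Ω → ℝ) (σ : Ω → M → ℝ) (ρ : M → A → ℝ) : Prop :=
  ∀ ρ' : M → A → ℝ, IsAct ρ' → U μ₀ uR σ ρ' ≤ U μ₀ uR σ ρ

/-- A cheap-talk equilibrium: a profile of valid strategies that is S-BR and R-BR. -/
def CTEq (μ₀ : Ω → ℝ) (uS uR : A × Ω → ℝ) (σ : Ω → M → ℝ) (ρ : M → A → ℝ) : Prop :=
  IsMsg σ ∧ IsAct ρ ∧ SBR μ₀ uS σ ρ ∧ RBR μ₀ uR σ ρ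

/-- A persuasion profile: a profile of valid strategies that is R-BR. -/
def PersProfile (μ₀ : Ω → ℝ) (uR : A × Ω → ℝ) (σ : Ω → M → ℝ) (ρ : M → A → ℝ) : Prop :=
  IsMsg σ ∧ IsAct ρ ∧ RBR μ₀ uR σ ρ

/-- The cheap-talk payoff: the maximal Sender payoff over cheap-talk equilibria. -/
noncomputable def ctPayoff (μ₀ : Ω → ℝ) (uS uR : A × Ω → ℝ) : ℝ :=
  sSup {x | ∃ (σ : Ω → M → ℝ) (ρ : M → A → ℝ), CTEq μ₀ uS uR σ ρ ∧ x = U μ₀ uS σ ρ}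

/-- The (Bayesian) persuasion payoff: the maximal Sender payoff over persuasion profiles. -/
noncomputable def persPayoff (μ₀ : Ω → ℝ) (uS uR : A × Ω → ℝ) : ℝ :=
  sSup {x | ∃ (σ : Ω → M → ℝ) (ρ : M → A → ℝ), PersProfile μ₀ uR σ ρ ∧ x = U μ₀ uS σ ρ}

/-- A messaging strategy is partitional if it is deterministic in every state. -/
def Partitional (σ : Ω → M → ℝ) : Prop := ∀ ω, ∃ m, σ ω m = 1

/-- The partitional persuasion payoff. -/
noncomputable def partPersPayoff (μ₀ : Ω → ℝ) (uS uR : A × Ω → ℝ) : ℝ :=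
  sSup {x | ∃ (σ : Ω → M → ℝ) (ρ : M → A → ℝ),
    Partitional σ ∧ PersProfile μ₀ uR σ ρ ∧ x = U μ₀ uS σ ρ}

/-- The partitional cheap-talk payoff. -/
noncomputable def partCtPayoff (μ₀ : Ω → ℝ) (uS uR : A × Ω → ℝ) : ℝ :=
  sSup {x | ∃ (σ : Ω → M → ℝ) (ρ : M → A → ℝ),
    Partitional σ ∧ CTEq μ₀ uS uR σ ρ ∧ x = U μ₀ uS σ ρ}

/-- A message is on-path if it is sent with positive probability in some state. -/
def OnPath (σ : Ω → M → ℝ) (m : M) : Prop := ∃ ω, 0 < σ ω m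

/-- A pure action strategy: degenerate after every message. -/
def IsPureAct (ρ : M → A → ℝ) : Prop := ∀ m, ∃ a, ρ m a = 1

/-- A pure-on-path action strategy: degenerate after every on-path message. -/
def PureOnPath (σ : Ω → M → ℝ) (ρ : M → A → ℝ) : Prop :=
  ∀ m, OnPath σ m → ∃ a, ρ m a = 1

/-- The posterior belief induced by message `m`. -/
noncomputable def post (μ₀ : Ω → ℝ) (σ : Ω → M → ℝ) (m : M) (ω : Ω) : ℝ :=
  μ₀ ω * σ ω m / ∑ ω', μ₀ ω' * σ ω' m

/-- The cube of environments `[0,1]^(2|A||Ω|)`. -/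
def EnvCube (Ω A : Type) : Set ((A × Ω → ℝ) × (A × Ω → ℝ)) :=
  {e | (∀ p, e.1 p ∈ Set.Icc (0 : ℝ) 1) ∧ ∀ p, e.2 p ∈ Set.Icc (0 : ℝ) 1}

/-- The cube of transparent environments `[0,1]^(|A|(|Ω|+1))`, points `(v, u_R)`. -/
def TransCube (Ω A : Type) : Set ((A → ℝ) × (A × Ω → ℝ)) :=
  {e | (∀ a, e.1 a ∈ Set.Icc (0 : ℝ) 1) ∧ ∀ p, e.2 p ∈ Set.Icc (0 : ℝ) 1}

open Classical in
/-- The expanded-indifference matrix `T^i`: rows `u_S(a_j,·) − u_S(a_i,·)` for `j ≠ i`,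
rows `u_R(a_j,·) − u_R(a_i,·)` for `j ≠ i`, and the rows of the identity matrix. -/
noncomputable def TMat (uS uR : A × Ω → ℝ) (i : A) :
    Matrix (({j : A // j ≠ i} ⊕ {j : A // j ≠ i}) ⊕ Ω) Ω ℝ :=
  Matrix.of fun r ω =>
    match r with
    | Sum.inl (Sum.inl j) => uS (j.1, ω) - uS (i, ω)
    | Sum.inl (Sum.inr j) => uR (j.1, ω) - uR (i, ω)
    | Sum.inr ω' => if ω' = ω then 1 else 0

/-- Scant indifferences: every row-submatrix of every expanded-indifference matrix has
full rank (rank equal to the minimum of the number of rows and the number of columns). -/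
def ScantIndiff (uS uR : A × Ω → ℝ) : Prop :=
  ∀ i : A, ∀ s : Finset (({j : A // j ≠ i} ⊕ {j : A // j ≠ i}) ⊕ Ω),
    ((TMat uS uR i).submatrix (fun r : {x // x ∈ s} => r.1) id).rank
      = min s.card (Fintype.card Ω)

open Classical in
/-- The set `Ω_a` of states in which `a` is an ideal action for Sender. -/
noncomputable def idealStates (uS : A × Ω → ℝ) (a : A) : Finset Ω :=
  Finset.univ.filter fun ω => ∀ b, uS (b, ω) ≤ uS (a, ω)

/-- Felicitous environment. -/
def Felicitous (μ₀ : Ω → ℝ) (uS uR : A × Ω → ℝ) : Prop :=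
  ∀ a a' : A, 0 ≤ ∑ ω ∈ idealStates uS a, μ₀ ω * (uR (a, ω) - uR (a', ω))

/-- Partitional-unique-response: for every nonempty subset of states, Receiver's
expected payoff has a unique maximizer. -/
def PUR (μ₀ : Ω → ℝ) (uR : A × Ω → ℝ) : Prop :=
  ∀ S : Finset Ω, S.Nonempty →
    ∃! a : A, ∀ b : A, ∑ ω ∈ S, μ₀ ω * uR (b, ω) ≤ ∑ ω ∈ S, μ₀ ω * uR (a, ω)

/-- Jointly-inclusive environment: each action is the unique ideal action of both
players in some state. -/
def JointlyInclusive (uS uR : A × Ω → ℝ) : Prop :=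
  ∀ a : A, ∃ ω : Ω,
    (∀ b, b ≠ a → uS (b, ω) < uS (a, ω)) ∧ ∀ b, b ≠ a → uR (b, ω) < uR (a, ω)

open Classical in
lemma best_iff {X Y : Type} [Fintype X] [Fintype Y] (f g : X → Y → ℝ)
    (hf : ∀ x, IsDist (f x)) :
    (∀ f' : X → Y → ℝ, (∀ x, IsDist (f' x)) →
      ∑ x, ∑ y, f' x y * g x y ≤ ∑ x, ∑ y, f x y * g x y) ↔
    ∀ x y, 0 < f x y → ∀ y', g x y' ≤ g x y := by
  constructor
  · intro h x0 y0 hpos y'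
    by_contra hlt
    push Not at hlt
    have hne : y0 ≠ y' := by rintro rfl; exact lt_irrefl _ hlt
    have key := h (fun x y => f x y + (if x = x0 then f x0 y0 *
      ((if y = y' then 1 else 0) - (if y = y0 then 1 else 0)) else 0)) ?_
    · simp only [add_mul, Finset.sum_add_distrib, ite_mul, zero_mul, mul_sub, sub_mul] at key
      have e : ∑ x, ∑ y, (if x = x0 then f x0 y0 * (if y = y' then (1:ℝ) else 0) * g x y
          - f x0 y0 * (if y = y0 then (1:ℝ) else 0) * g x y else 0)
          = f x0 y0 * (g x0 y' - g x0 y0) := by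
        rw [Finset.sum_eq_single x0]
        · simp [Finset.sum_sub_distrib, mul_sub]
        · intro b _ hb
          simp [hb]
        · simp
      rw [e] at key
      have : 0 < f x0 y0 * (g x0 y' - g x0 y0) := mul_pos hpos (by linarith)
      linarith
    · intro x
      constructor
      · intro y
        have h0 := (hf x).1 y
        by_cases hx : x = x0
        · subst hx
          by_cases h1 : y = y0
          · subst h1
            simp [hne]
          · simp only [if_true, h1, if_false]
            split_ifs <;> simp <;> linarith
        · simp [hx, h0]
      · rw [Finset.sum_add_distrib, (hf x).2]
        by_cases hx : x = x0
        · simp [hx, mul_sub, Finset.sum_sub_distrib]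
        · simp [hx]
  · intro h f' hf'
    refine Finset.sum_le_sum fun x _ => ?_
    obtain ⟨y0, hy0⟩ : ∃ y0, 0 < f x y0 := by
      by_contra hc
      push Not at hc
      have : ∑ y, f x y ≤ 0 := Finset.sum_nonpos fun y _ => hc y
      rw [(hf x).2] at this
      linarith
    have e1 : ∑ y, f x y * g x y = g x y0 := by
      have : ∀ y, f x y * g x y = f x y * g x y0 := by
        intro y
        rcases ((hf x).1 y).eq_or_lt with h0 | h0
        · rw [← h0]; ring
        · rw [le_antisymm (h x y0 hy0 y) (h x y h0 y0)]
      rw [Finset.sum_congr rfl fun y _ => this y, ← Finset.sum_mul, (hf x).2, one_mul]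
    rw [e1]
    calc ∑ y, f' x y * g x y ≤ ∑ y, f' x y * g x y0 :=
          Finset.sum_le_sum fun y _ => mul_le_mul_of_nonneg_left (h x y0 hy0 y) ((hf' x).1 y)
      _ = g x y0 := by rw [← Finset.sum_mul, (hf' x).2, one_mul]

lemma U_eq_R (μ₀ : Ω → ℝ) (u : A × Ω → ℝ) (σ : Ω → M → ℝ) (ρ : M → A → ℝ) :
    U μ₀ u σ ρ = ∑ m, ∑ a, ρ m a * ∑ ω, μ₀ ω * σ ω m * u (a, ω) := by
  unfold U
  rw [Finset.sum_comm]
  refine Finset.sum_congr rfl fun m _ => ?_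
  rw [Finset.sum_comm]
  refine Finset.sum_congr rfl fun a _ => ?_
  rw [Finset.mul_sum]
  exact Finset.sum_congr rfl fun ω _ => by ring

lemma U_eq_S (μ₀ : Ω → ℝ) (u : A × Ω → ℝ) (σ : Ω → M → ℝ) (ρ : M → A → ℝ) :
    U μ₀ u σ ρ = ∑ ω, ∑ m, σ ω m * (μ₀ ω * ∑ a, ρ m a * u (a, ω)) := by
  unfold U
  refine Finset.sum_congr rfl fun ω _ => Finset.sum_congr rfl fun m _ => ?_
  rw [Finset.mul_sum, Finset.mul_sum]
  exact Finset.sum_congr rfl fun a _ => by ring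

lemma U_eq_pi (μ₀ : Ω → ℝ) (u : A × Ω → ℝ) (σ : Ω → M → ℝ) (ρ : M → A → ℝ) :
    U μ₀ u σ ρ = ∑ a, ∑ ω, (∑ m, μ₀ ω * σ ω m * ρ m a) * u (a, ω) := by
  unfold U
  simp only [Finset.sum_mul]
  refine Eq.trans ?_ Finset.sum_comm
  refine Finset.sum_congr rfl fun ω _ => ?_
  rw [Finset.sum_comm]

lemma RBR_iff (μ₀ : Ω → ℝ) (uR : A × Ω → ℝ) (σ : Ω → M → ℝ) (ρ : M → A → ℝ) (hρ : IsAct ρ) :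
    RBR μ₀ uR σ ρ ↔ ∀ m a, 0 < ρ m a → ∀ b,
      ∑ ω, μ₀ ω * σ ω m * uR (b, ω) ≤ ∑ ω, μ₀ ω * σ ω m * uR (a, ω) := by
  unfold RBR
  simp only [U_eq_R]
  exact best_iff ρ (fun m a => ∑ ω, μ₀ ω * σ ω m * uR (a, ω)) hρ

lemma SBR_iff (μ₀ : Ω → ℝ) (hμ : IsPrior μ₀) (uS : A × Ω → ℝ) (σ : Ω → M → ℝ) (ρ : M → A → ℝ)
    (hσ : IsMsg σ) :
    SBR μ₀ uS σ ρ ↔ ∀ ω m, 0 < σ ω m → ∀ m',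
      ∑ a, ρ m' a * uS (a, ω) ≤ ∑ a, ρ m a * uS (a, ω) := by
  unfold SBR
  simp only [U_eq_S]
  refine (best_iff σ (fun ω m => μ₀ ω * ∑ a, ρ m a * uS (a, ω)) hσ).trans ?_
  refine forall_congr' fun ω => forall_congr' fun m => imp_congr_right fun _ =>
    forall_congr' fun m' => ?_
  exact mul_le_mul_iff_right₀ (hμ.1 ω)

lemma isDist_single {X : Type} [Fintype X] [DecidableEq X] (x : X) :
    IsDist (fun y => if y = x then (1:ℝ) else 0) := by
  constructor
  · intro y; dsimp only; split_ifs <;> norm_num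
  · simp

lemma IsDist.exists_pos {X : Type} [Fintype X] {f : X → ℝ} (h : IsDist f) : ∃ x, 0 < f x := by
  by_contra hc
  push Not at hc
  have : ∑ y, f y ≤ 0 := Finset.sum_nonpos fun y _ => hc y
  rw [h.2] at this
  linarith

lemma IsDist.le_one {X : Type} [Fintype X] {f : X → ℝ} (h : IsDist f) (x : X) : f x ≤ 1 := by
  rw [← h.2]
  exact Finset.single_le_sum (fun y _ => h.1 y) (Finset.mem_univ x)

open Classical in
/-- If only `x` can carry mass then `f` is the point mass at `x`. -/
lemma IsDist.eq_single {X : Type} [Fintype X] {f : X → ℝ} (h : IsDist f) {x : X}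
    (hx : ∀ y, 0 < f y → y = x) : ∀ y, f y = if y = x then 1 else 0 := by
  have h0 : ∀ y, y ≠ x → f y = 0 := fun y hy =>
    le_antisymm (not_lt.1 fun hp => hy (hx y hp)) (h.1 y)
  intro y
  by_cases hy : y = x
  · subst hy
    have := h.2
    rw [Finset.sum_eq_single y (fun b _ hb => h0 b hb) (by simp)] at this
    simp [this]
  · simp [hy, h0 y hy]

/-- Obedient outcomes: joint distributions over actions and states. -/
structure Obed (μ₀ : Ω → ℝ) (uR : A × Ω → ℝ) (π : A → Ω → ℝ) : Prop where
  nonneg : ∀ a ω, 0 ≤ π a ω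
  marg : ∀ ω, ∑ a, π a ω = μ₀ ω
  obey : ∀ a b, ∑ ω, π a ω * uR (b, ω) ≤ ∑ ω, π a ω * uR (a, ω)

lemma PersProfile.obed {μ₀ : Ω → ℝ} (hμ : IsPrior μ₀) {uR : A × Ω → ℝ} {σ : Ω → M → ℝ}
    {ρ : M → A → ℝ} (h : PersProfile μ₀ uR σ ρ) :
    Obed μ₀ uR (fun a ω => ∑ m, μ₀ ω * σ ω m * ρ m a) := by
  obtain ⟨hσ, hρ, hR⟩ := h
  rw [RBR_iff _ _ _ _ hρ] at hR
  refine ⟨?_, ?_, ?_⟩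
  · intro a ω
    exact Finset.sum_nonneg fun m _ =>
      mul_nonneg (mul_nonneg (hμ.1 ω).le ((hσ ω).1 m)) ((hρ m).1 a)
  · intro ω
    rw [Finset.sum_comm]
    simp only [← Finset.mul_sum, (hρ _).2, mul_one, (hσ _).2]
  · intro a b
    have e : ∀ c, ∑ ω, (∑ m, μ₀ ω * σ ω m * ρ m a) * uR (c, ω)
        = ∑ m, ρ m a * ∑ ω, μ₀ ω * σ ω m * uR (c, ω) := by
      intro c
      simp only [Finset.sum_mul, Finset.mul_sum]
      rw [Finset.sum_comm]
      exact Finset.sum_congr rfl fun m _ => Finset.sum_congr rfl fun ω _ => by ring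
    rw [e, e]
    refine Finset.sum_le_sum fun m _ => ?_
    rcases ((hρ m).1 a).eq_or_lt with h0 | h0
    · rw [← h0]; simp
    · exact mul_le_mul_of_nonneg_left (hR m a h0 b) h0.le

open Classical in
lemma Obed.exists_profile [Nonempty A] (hM : Fintype.card A < Fintype.card M)
    {μ₀ : Ω → ℝ} (hμ : IsPrior μ₀) {uR : A × Ω → ℝ} {π : A → Ω → ℝ} (h : Obed μ₀ uR π) :
    ∃ (σ : Ω → M → ℝ) (ρ : M → A → ℝ), PersProfile μ₀ uR σ ρ ∧
      (∀ u : A × Ω → ℝ, U μ₀ u σ ρ = ∑ a, ∑ ω, π a ω * u (a, ω)) ∧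
      ∀ a, ∃ m, ∀ ω, σ ω m = π a ω / μ₀ ω := by
  obtain ⟨i⟩ : Nonempty (A ↪ M) := Function.Embedding.nonempty_of_card_le hM.le
  set j : M → A := Function.invFun i with hj
  have hji : ∀ a, j (i a) = a := Function.leftInverse_invFun i.injective
  let σ : Ω → M → ℝ := fun ω m => ∑ a, if m = i a then π a ω / μ₀ ω else 0
  let ρ : M → A → ℝ := fun m a => if a = j m then 1 else 0
  have hρ : IsAct ρ := fun m => isDist_single (j m)
  have hσi : ∀ ω a, σ ω (i a) = π a ω / μ₀ ω := by
    intro ω a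
    simp [σ]
  have hmul : ∀ ω a, μ₀ ω * (π a ω / μ₀ ω) = π a ω := fun ω a =>
    mul_div_cancel₀ _ (hμ.1 ω).ne'
  have hσ : IsMsg σ := by
    intro ω
    constructor
    · intro m
      refine Finset.sum_nonneg fun a _ => ?_
      split_ifs
      · exact div_nonneg (h.nonneg a ω) (hμ.1 ω).le
      · exact le_rfl
    · simp only [σ]
      rw [Finset.sum_comm]
      simp only [Finset.sum_ite_eq', Finset.mem_univ, if_true]
      rw [← Finset.sum_div, h.marg, div_self (hμ.1 ω).ne']
  refine ⟨σ, ρ, ⟨hσ, hρ, ?_⟩, ?_, fun a => ⟨i a, fun ω => hσi ω a⟩⟩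
  · rw [RBR_iff _ _ _ _ hρ]
    intro m a ha b
    have hja : a = j m := by
      by_contra hne
      simp [ρ, hne] at ha
    by_cases hm : ∃ c, m = i c
    · obtain ⟨c, rfl⟩ := hm
      rw [hji] at hja
      subst hja
      simp only [hσi, hmul]
      exact h.obey a b
    · push Not at hm
      have : ∀ ω, σ ω m = 0 := fun ω => Finset.sum_eq_zero fun c _ => by simp [hm c]
      simp [this]
  · intro u
    rw [U_eq_pi]
    refine Finset.sum_congr rfl fun a _ => Finset.sum_congr rfl fun ω _ => ?_
    congr 1
    have : ∀ m, μ₀ ω * σ ω m * ρ m a = if m = i a then π a ω else 0 := by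
      intro m
      simp only [σ, ρ]
      by_cases hm : ∃ c, m = i c
      · obtain ⟨c, rfl⟩ := hm
        rw [hji]
        by_cases hac : a = c
        · subst hac
          simp [hmul]
        · have : ¬ c = a := fun h => hac h.symm
          simp [hac, this]
      · push Not at hm
        simp [hm]
    rw [Finset.sum_congr rfl fun m _ => this m]
    simp

set_option linter.unusedSectionVars false

/-! ### Compactness and attainment -/

lemma isCompact_dist {X : Type} [Fintype X] : IsCompact {f : X → ℝ | IsDist f} := by
  have hsub : {f : X → ℝ | IsDist f} ⊆ Set.pi Set.univ (fun _ => Set.Icc (0:ℝ) 1) := by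
    intro f hf x _
    exact ⟨hf.1 x, IsDist.le_one hf x⟩
  refine IsCompact.of_isClosed_subset (isCompact_univ_pi fun _ => isCompact_Icc) ?_ hsub
  have : {f : X → ℝ | IsDist f} = (⋂ x, {f : X → ℝ | 0 ≤ f x}) ∩ {f | ∑ x, f x = 1} := by
    ext f; simp [IsDist]
  rw [this]
  refine IsClosed.inter (isClosed_iInter fun x => isClosed_le continuous_const (by fun_prop))
    (isClosed_eq (by fun_prop) continuous_const)

lemma isCompact_profiles :
    IsCompact {p : (Ω → M → ℝ) × (M → A → ℝ) | IsMsg p.1 ∧ IsAct p.2} := by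
  have h1 : IsCompact (Set.pi Set.univ (fun _ : Ω => {f : M → ℝ | IsDist f})) :=
    isCompact_univ_pi fun _ => isCompact_dist
  have h2 : IsCompact (Set.pi Set.univ (fun _ : M => {f : A → ℝ | IsDist f})) :=
    isCompact_univ_pi fun _ => isCompact_dist
  convert h1.prod h2 using 1
  ext p
  simp [IsMsg, IsAct]

lemma continuous_U (μ₀ : Ω → ℝ) (u : A × Ω → ℝ) :
    Continuous fun p : (Ω → M → ℝ) × (M → A → ℝ) => U μ₀ u p.1 p.2 := by
  unfold U
  fun_prop

lemma isClosed_RBR (μ₀ : Ω → ℝ) (u : A × Ω → ℝ) :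
    IsClosed {p : (Ω → M → ℝ) × (M → A → ℝ) | RBR μ₀ u p.1 p.2} := by
  have : {p : (Ω → M → ℝ) × (M → A → ℝ) | RBR μ₀ u p.1 p.2} =
      ⋂ ρ' : M → A → ℝ, ⋂ _ : IsAct ρ', {p | U μ₀ u p.1 ρ' ≤ U μ₀ u p.1 p.2} := by
    ext p; simp [RBR]
  rw [this]
  refine isClosed_iInter fun ρ' => isClosed_iInter fun _ => isClosed_le ?_ (continuous_U μ₀ u)
  unfold U
  fun_prop

lemma isClosed_SBR (μ₀ : Ω → ℝ) (u : A × Ω → ℝ) :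
    IsClosed {p : (Ω → M → ℝ) × (M → A → ℝ) | SBR μ₀ u p.1 p.2} := by
  have : {p : (Ω → M → ℝ) × (M → A → ℝ) | SBR μ₀ u p.1 p.2} =
      ⋂ σ' : Ω → M → ℝ, ⋂ _ : IsMsg σ', {p | U μ₀ u σ' p.2 ≤ U μ₀ u p.1 p.2} := by
    ext p; simp [SBR]
  rw [this]
  refine isClosed_iInter fun ρ' => isClosed_iInter fun _ => isClosed_le ?_ (continuous_U μ₀ u)
  unfold U
  fun_prop

lemma isClosed_Part :
    IsClosed {p : (Ω → M → ℝ) × (M → A → ℝ) | Partitional p.1} := by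
  simp only [Partitional, Set.ofPred_forall, Set.ofPred_exists]
  refine isClosed_iInter fun ω => isClosed_iUnion_of_finite fun m =>
    isClosed_eq (by fun_prop) continuous_const

lemma isCompact_pers (μ₀ : Ω → ℝ) (uS uR : A × Ω → ℝ) :
    IsCompact {x | ∃ (σ : Ω → M → ℝ) (ρ : M → A → ℝ),
      PersProfile μ₀ uR σ ρ ∧ x = U μ₀ uS σ ρ} := by
  have h := (isCompact_profiles (Ω := Ω) (A := A) (M := M)).inter_right (isClosed_RBR μ₀ uR)
  convert h.image (continuous_U μ₀ uS) using 1
  ext x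
  simp [PersProfile, and_assoc, eq_comm]

lemma isCompact_part (μ₀ : Ω → ℝ) (uS uR : A × Ω → ℝ) :
    IsCompact {x | ∃ (σ : Ω → M → ℝ) (ρ : M → A → ℝ),
      Partitional σ ∧ PersProfile μ₀ uR σ ρ ∧ x = U μ₀ uS σ ρ} := by
  have h := ((isCompact_profiles (Ω := Ω) (A := A) (M := M)).inter_right
    (isClosed_RBR μ₀ uR)).inter_left isClosed_Part
  convert h.image (continuous_U μ₀ uS) using 1
  ext x
  simp [PersProfile, and_assoc, eq_comm]

lemma isCompact_ct (μ₀ : Ω → ℝ) (uS uR : A × Ω → ℝ) :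
    IsCompact {x | ∃ (σ : Ω → M → ℝ) (ρ : M → A → ℝ),
      CTEq μ₀ uS uR σ ρ ∧ x = U μ₀ uS σ ρ} := by
  have h := ((isCompact_profiles (Ω := Ω) (A := A) (M := M)).inter_right
    (isClosed_SBR μ₀ uS)).inter_right (isClosed_RBR μ₀ uR)
  convert h.image (continuous_U μ₀ uS) using 1
  ext x
  simp [CTEq, and_assoc, eq_comm]

open Classical in
/-- The babbling equilibrium. -/
lemma exists_babbling [Nonempty A] [Nonempty M] (μ₀ : Ω → ℝ) (hμ : IsPrior μ₀)
    (uS uR : A × Ω → ℝ) :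
    ∃ (σ : Ω → M → ℝ) (ρ : M → A → ℝ), Partitional σ ∧ CTEq μ₀ uS uR σ ρ := by
  obtain ⟨m0⟩ := ‹Nonempty M›
  obtain ⟨a0, ha0⟩ := Finite.exists_max (fun a : A => ∑ ω, μ₀ ω * uR (a, ω))
  have hσ : IsMsg (fun (_ : Ω) m => if m = m0 then (1:ℝ) else 0) := fun _ => isDist_single m0
  have hρ : IsAct (fun (_ : M) a => if a = a0 then (1:ℝ) else 0) := fun _ => isDist_single a0
  refine ⟨_, _, fun ω => ⟨m0, if_pos rfl⟩, hσ, hρ, ?_, ?_⟩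
  · rw [SBR_iff _ hμ _ _ _ hσ]
    intro ω m _ m'
    exact le_rfl
  · rw [RBR_iff _ _ _ _ hρ]
    intro m a ha b
    have : a = a0 := by
      by_contra hne
      simp [hne] at ha
    subst this
    by_cases hm : m = m0
    · simpa [hm] using ha0 b
    · simp [hm]

section payoffs
variable [Nonempty A] [Nonempty M] {μ₀ : Ω → ℝ} {uS uR : A × Ω → ℝ}

lemma le_pers {σ : Ω → M → ℝ} {ρ : M → A → ℝ} (h : PersProfile μ₀ uR σ ρ) :
    U μ₀ uS σ ρ ≤ persPayoff (M := M) μ₀ uS uR :=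
  le_csSup (isCompact_pers μ₀ uS uR).bddAbove ⟨σ, ρ, h, rfl⟩

lemma le_part {σ : Ω → M → ℝ} {ρ : M → A → ℝ} (hp : Partitional σ) (h : PersProfile μ₀ uR σ ρ) :
    U μ₀ uS σ ρ ≤ partPersPayoff (M := M) μ₀ uS uR :=
  le_csSup (isCompact_part μ₀ uS uR).bddAbove ⟨σ, ρ, hp, h, rfl⟩

lemma le_ct {σ : Ω → M → ℝ} {ρ : M → A → ℝ} (h : CTEq μ₀ uS uR σ ρ) :
    U μ₀ uS σ ρ ≤ ctPayoff (M := M) μ₀ uS uR :=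
  le_csSup (isCompact_ct μ₀ uS uR).bddAbove ⟨σ, ρ, h, rfl⟩

lemma exists_part (hμ : IsPrior μ₀) : ∃ (σ : Ω → M → ℝ) (ρ : M → A → ℝ),
    Partitional σ ∧ PersProfile μ₀ uR σ ρ ∧ U μ₀ uS σ ρ = partPersPayoff (M := M) μ₀ uS uR := by
  obtain ⟨σ, ρ, hp, h⟩ := exists_babbling (M := M) μ₀ hμ uS uR
  obtain ⟨σ', ρ', h1, h2, h3⟩ := (isCompact_part (M := M) μ₀ uS uR).sSup_mem
    ⟨_, σ, ρ, hp, ⟨h.1, h.2.1, h.2.2.2⟩, rfl⟩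
  exact ⟨σ', ρ', h1, h2, h3.symm⟩

lemma exists_ct (hμ : IsPrior μ₀) : ∃ (σ : Ω → M → ℝ) (ρ : M → A → ℝ),
    CTEq μ₀ uS uR σ ρ ∧ U μ₀ uS σ ρ = ctPayoff (M := M) μ₀ uS uR := by
  obtain ⟨σ, ρ, hp, h⟩ := exists_babbling (M := M) μ₀ hμ uS uR
  obtain ⟨σ', ρ', h2, h3⟩ := (isCompact_ct (M := M) μ₀ uS uR).sSup_mem
    ⟨_, σ, ρ, h, rfl⟩
  exact ⟨σ', ρ', h2, h3.symm⟩

end payoffs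

/-! ### Local perturbations of an optimal obedient outcome -/

open Classical in
lemma perturb {μ₀ : Ω → ℝ} {uS uR : A × Ω → ℝ} {π : A → Ω → ℝ} (h : Obed μ₀ uR π)
    (hopt : ∀ π' : A → Ω → ℝ, Obed μ₀ uR π' →
      ∑ a, ∑ ω, π' a ω * uS (a, ω) ≤ ∑ a, ∑ ω, π a ω * uS (a, ω))
    {a0 a1 : A} (hne : a0 ≠ a1) (x : Ω → ℝ)
    (h0 : ∀ ω, 0 < x ω → 0 < π a0 ω) (h1 : ∀ ω, x ω < 0 → 0 < π a1 ω)
    (hb1 : ∀ b, ∑ ω, π a1 ω * uR (b, ω) < ∑ ω, π a1 ω * uR (a1, ω) ∨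
      ∑ ω, x ω * uR (b, ω) ≤ ∑ ω, x ω * uR (a1, ω))
    (hb0 : ∀ b, ∑ ω, π a0 ω * uR (b, ω) < ∑ ω, π a0 ω * uR (a0, ω) ∨
      ∑ ω, x ω * uR (a0, ω) ≤ ∑ ω, x ω * uR (b, ω)) :
    ∑ ω, x ω * uS (a1, ω) ≤ ∑ ω, x ω * uS (a0, ω) := by
  -- an affine function that is positive at 0, or nonnegative at 0 with nonnegative slope
  have aff : ∀ c d : ℝ, 0 ≤ c → (0 < c ∨ 0 ≤ d) →
      ∀ᶠ ε in nhdsWithin (0:ℝ) (Set.Ioi 0), 0 ≤ c + ε * d := by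
    intro c d hc hcd
    rcases hcd with hc' | hd
    · have : Filter.Tendsto (fun ε : ℝ => c + ε * d) (nhds 0) (nhds (c + 0 * d)) :=
        Continuous.tendsto (by fun_prop) 0
      have h2 := this.eventually (lt_mem_nhds (a := 0) (by simpa using hc'))
      exact (h2.filter_mono nhdsWithin_le_nhds).mono fun _ h => h.le
    · filter_upwards [self_mem_nhdsWithin] with ε hε
      have : 0 ≤ ε * d := mul_nonneg (le_of_lt hε) hd
      linarith
  have E1 : ∀ ω, ∀ᶠ ε in nhdsWithin (0:ℝ) (Set.Ioi 0), 0 ≤ π a1 ω + ε * x ω := fun ω =>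
    aff _ _ (h.nonneg _ _) (by
      rcases lt_or_ge (x ω) 0 with hx | hx
      · exact Or.inl (h1 ω hx)
      · exact Or.inr hx)
  have E0 : ∀ ω, ∀ᶠ ε in nhdsWithin (0:ℝ) (Set.Ioi 0), 0 ≤ π a0 ω + ε * (-x ω) := fun ω =>
    aff _ _ (h.nonneg _ _) (by
      rcases lt_or_ge 0 (x ω) with hx | hx
      · exact Or.inl (h0 ω hx)
      · exact Or.inr (by linarith))
  have F1 : ∀ b, ∀ᶠ ε in nhdsWithin (0:ℝ) (Set.Ioi 0),
      0 ≤ (∑ ω, π a1 ω * uR (a1, ω) - ∑ ω, π a1 ω * uR (b, ω))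
        + ε * (∑ ω, x ω * uR (a1, ω) - ∑ ω, x ω * uR (b, ω)) := fun b =>
    aff _ _ (sub_nonneg.2 (h.obey _ _)) ((hb1 b).imp sub_pos.2 sub_nonneg.2)
  have F0 : ∀ b, ∀ᶠ ε in nhdsWithin (0:ℝ) (Set.Ioi 0),
      0 ≤ (∑ ω, π a0 ω * uR (a0, ω) - ∑ ω, π a0 ω * uR (b, ω))
        + ε * (∑ ω, x ω * uR (b, ω) - ∑ ω, x ω * uR (a0, ω)) := fun b =>
    aff _ _ (sub_nonneg.2 (h.obey _ _)) ((hb0 b).imp sub_pos.2 sub_nonneg.2)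
  obtain ⟨ε, ⟨⟨⟨e1, e0⟩, f1⟩, f0⟩, hε⟩ := ((((Filter.eventually_all.2 E1).and
    (Filter.eventually_all.2 E0)).and (Filter.eventually_all.2 F1)).and
    (Filter.eventually_all.2 F0)).and self_mem_nhdsWithin |>.exists
  have hε : 0 < ε := hε
  let π' : A → Ω → ℝ := fun a ω => π a ω + ((if a = a1 then ε * x ω else 0)
    - (if a = a0 then ε * x ω else 0))
  have p1 : ∀ ω, π' a1 ω = π a1 ω + ε * x ω := fun ω => by simp [π', hne.symm]
  have p0 : ∀ ω, π' a0 ω = π a0 ω - ε * x ω := fun ω => by simp [π', hne]; ring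
  have p2 : ∀ a ω, a ≠ a0 → a ≠ a1 → π' a ω = π a ω := fun a ω ha hb => by simp [π', ha, hb]
  have hO : Obed μ₀ uR π' := by
    refine ⟨?_, ?_, ?_⟩
    · intro a ω
      by_cases ha1 : a = a1
      · subst ha1; rw [p1]; exact e1 ω
      · by_cases ha0 : a = a0
        · subst ha0; rw [p0]; have := e0 ω; linarith
        · rw [p2 a ω ha0 ha1]; exact h.nonneg a ω
    · intro ω
      simp [π', Finset.sum_add_distrib, h.marg]
    · intro a b
      by_cases ha1 : a = a1
      · subst ha1
        have := f1 b
        simp only [p1, add_mul, Finset.sum_add_distrib, mul_assoc, ← Finset.mul_sum]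
        linarith
      · by_cases ha0 : a = a0
        · subst ha0
          have := f0 b
          simp only [p0, sub_mul, Finset.sum_sub_distrib, mul_assoc, ← Finset.mul_sum]
          linarith
        · simp only [p2 a _ ha0 ha1]
          exact h.obey a b
  have key := hopt π' hO
  have e : ∑ a, ∑ ω, π' a ω * uS (a, ω) = ∑ a, ∑ ω, π a ω * uS (a, ω)
      + ε * (∑ ω, x ω * uS (a1, ω) - ∑ ω, x ω * uS (a0, ω)) := by
    simp only [π', add_mul, sub_mul, Finset.sum_add_distrib, Finset.sum_sub_distrib, ite_mul,
      zero_mul]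
    rw [Finset.sum_comm (s := Finset.univ) (t := Finset.univ)
      (f := fun a ω => if a = a1 then ε * x ω * uS (a, ω) else 0),
      Finset.sum_comm (s := Finset.univ) (t := Finset.univ)
      (f := fun a ω => if a = a0 then ε * x ω * uS (a, ω) else 0)]
    simp [mul_assoc, ← Finset.mul_sum, mul_sub]
  rw [e] at key
  by_contra hlt
  push Not at hlt
  have := mul_pos hε (sub_pos.2 hlt)
  linarith

/-! ### Genericity -/

/-- Kernel of Receiver indifferences among `C ∪ {a0}`, supported on `S`. -/
def Ker (uR : A × Ω → ℝ) (a0 : A) (C : Finset A) (S : Finset Ω) (x : Ω → ℝ) : Prop :=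
  (∀ ω, ω ∉ S → x ω = 0) ∧ ∀ b ∈ C, ∑ ω, x ω * (uR (b, ω) - uR (a0, ω)) = 0

def Gen1 (uS uR : A × Ω → ℝ) (a0 a1 : A) (C : Finset A) (S : Finset Ω) : Prop :=
  (∃ x, x ≠ 0 ∧ Ker uR a0 C S x) →
    ∃ x, Ker uR a0 C S x ∧ ∑ ω, x ω * (uS (a1, ω) - uS (a0, ω)) ≠ 0

/-- The zero set of a nonzero linear functional is null. -/
lemma null_of_linear {E : Type*} [NormedAddCommGroup E] [NormedSpace ℝ E] [MeasurableSpace E]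
    [BorelSpace E] [FiniteDimensional ℝ E] (ν : Measure E) [ν.IsAddHaarMeasure] (L : E →ₗ[ℝ] ℝ)
    (hL : L ≠ 0) : ν {e | L e = 0} = 0 := by
  have := Measure.addHaar_submodule ν (LinearMap.ker L)
    (fun h => hL (LinearMap.ker_eq_top.1 h))
  exact this

open Classical in
lemma null_diff {a0 a1 : A} (hne : a0 ≠ a1) {x : Ω → ℝ} (hx : x ≠ 0) :
    volume {u : A × Ω → ℝ | ∑ ω, x ω * (u (a1, ω) - u (a0, ω)) = 0} = 0 := by
  let L : (A × Ω → ℝ) →ₗ[ℝ] ℝ :=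
    ∑ ω, x ω • ((LinearMap.proj (a1, ω) : (A × Ω → ℝ) →ₗ[ℝ] ℝ) - LinearMap.proj (a0, ω))
  have hLu : ∀ u, L u = ∑ ω, x ω * (u (a1, ω) - u (a0, ω)) := by
    intro u
    simp [L, LinearMap.sum_apply]
  have hL : L ≠ 0 := by
    intro h0
    obtain ⟨ω0, hω0⟩ := Function.ne_iff.1 hx
    have := hLu (Pi.single (a1, ω0) 1)
    rw [h0] at this
    simp [Pi.single_apply, hne] at this
    exact hω0 this.symm
  have := null_of_linear (volume : Measure (A × Ω → ℝ)) L hL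
  simpa only [hLu] using this

lemma isClosed_Ker (a0 : A) (C : Finset A) (S : Finset Ω) :
    IsClosed {p : ((A × Ω → ℝ) × (A × Ω → ℝ)) × (Ω → ℝ) | Ker p.1.2 a0 C S p.2} := by
  have : {p : ((A × Ω → ℝ) × (A × Ω → ℝ)) × (Ω → ℝ) | Ker p.1.2 a0 C S p.2} =
      (⋂ ω, ⋂ _ : ω ∉ S, {p | p.2 ω = 0}) ∩
      ⋂ b, ⋂ _ : b ∈ C, {p | ∑ ω, p.2 ω * (p.1.2 (b, ω) - p.1.2 (a0, ω)) = 0} := by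
    ext p; simp [Ker]
  rw [this]
  refine IsClosed.inter
    (isClosed_iInter fun ω => isClosed_iInter fun _ => isClosed_eq ?_ continuous_const)
    (isClosed_iInter fun ω => isClosed_iInter fun _ => isClosed_eq ?_ continuous_const)
  · fun_prop
  · fun_prop

lemma isClosed_proj {E F : Type*} [TopologicalSpace E] [TopologicalSpace F] {K : Set F}
    (hK : IsCompact K) {Z : Set (E × F)} (hZ : IsClosed Z) :
    IsClosed {e | ∃ x ∈ K, (e, x) ∈ Z} := by
  have := isCompact_iff_compactSpace.1 hK
  have h := isClosedMap_fst_of_compactSpace (X := E) (Y := K)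
    _ (hZ.preimage (f := fun p : E × K => (p.1, (p.2 : F))) (by fun_prop))
  convert h using 1
  ext e
  simp

lemma Ker.smul {uR : A × Ω → ℝ} {a0 : A} {C : Finset A} {S : Finset Ω} {x : Ω → ℝ}
    (h : Ker uR a0 C S x) (c : ℝ) : Ker uR a0 C S (c • x) := by
  refine ⟨fun ω hω => by simp [h.1 ω hω], fun b hb => ?_⟩
  simp only [Pi.smul_apply, smul_eq_mul, mul_assoc, ← Finset.mul_sum, h.2 b hb, mul_zero]

lemma ae_Gen1 {a0 a1 : A} (hne : a0 ≠ a1) (C : Finset A) (S : Finset Ω) :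
    ∀ᵐ e : (A × Ω → ℝ) × (A × Ω → ℝ), Gen1 e.1 e.2 a0 a1 C S := by
  have hZ : IsClosed {e : (A × Ω → ℝ) × (A × Ω → ℝ) | ∃ x, x ≠ 0 ∧ Ker e.2 a0 C S x} := by
    convert isClosed_proj (isCompact_sphere (0 : Ω → ℝ) 1) (isClosed_Ker (Ω := Ω) a0 C S) using 1
    ext e
    constructor
    · rintro ⟨x, hx, hk⟩
      refine ⟨‖x‖⁻¹ • x, ?_, hk.smul _⟩
      simp [norm_smul, hx]
    · rintro ⟨x, hx, hk⟩
      refine ⟨x, ?_, hk⟩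
      rintro rfl
      simp at hx
  have hW : MeasurableSet {e : (A × Ω → ℝ) × (A × Ω → ℝ) | ∃ x, Ker e.2 a0 C S x ∧
      ∑ ω, x ω * (e.1 (a1, ω) - e.1 (a0, ω)) ≠ 0} := by
    have hcl : ∀ n : ℕ, IsClosed {e : (A × Ω → ℝ) × (A × Ω → ℝ) |
        ∃ x ∈ Metric.closedBall (0 : Ω → ℝ) n, (e, x) ∈
          ({p | Ker p.1.2 a0 C S p.2} ∩ {p : ((A × Ω → ℝ) × (A × Ω → ℝ)) × (Ω → ℝ) |
            1 ≤ ∑ ω, p.2 ω * (p.1.1 (a1, ω) - p.1.1 (a0, ω))})} := fun n =>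
      isClosed_proj (isCompact_closedBall _ _)
        ((isClosed_Ker a0 C S).inter (isClosed_le continuous_const (by fun_prop)))
    convert MeasurableSet.iUnion fun n => (hcl n).measurableSet using 1
    ext e
    simp only [Set.mem_iUnion]
    constructor
    · rintro ⟨x, hk, hx⟩
      set c := ∑ ω, x ω * (e.1 (a1, ω) - e.1 (a0, ω)) with hc
      obtain ⟨n, hn⟩ := exists_nat_ge ‖c⁻¹ • x‖
      refine ⟨n, c⁻¹ • x, by simpa using hn, hk.smul _, ?_⟩
      simp only [Set.mem_ofPred_eq, Pi.smul_apply, smul_eq_mul, mul_assoc, ← Finset.mul_sum]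
      rw [← hc, inv_mul_cancel₀ hx]
    · rintro ⟨n, x, _, hk, hx⟩
      refine ⟨x, hk, ?_⟩
      have hx : 1 ≤ ∑ ω, x ω * (e.1 (a1, ω) - e.1 (a0, ω)) := hx
      intro h0
      rw [h0] at hx
      linarith
  rw [ae_iff]
  have hbad : {e : (A × Ω → ℝ) × (A × Ω → ℝ) | ¬ Gen1 e.1 e.2 a0 a1 C S} =
      {e | ∃ x, x ≠ 0 ∧ Ker e.2 a0 C S x} \ {e | ∃ x, Ker e.2 a0 C S x ∧
      ∑ ω, x ω * (e.1 (a1, ω) - e.1 (a0, ω)) ≠ 0} := by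
    ext e
    simp only [Gen1, Set.mem_sdiff, Set.mem_ofPred_eq, Classical.not_imp]
  rw [hbad, Measure.volume_eq_prod, Measure.prod_apply_symm (hZ.measurableSet.diff hW)]
  refine (lintegral_congr fun uR => ?_).trans lintegral_zero
  by_cases hex : ∃ x, x ≠ 0 ∧ Ker uR a0 C S x
  · obtain ⟨x, hx, hk⟩ := hex
    refine measure_mono_null ?_ (null_diff hne hx)
    rintro uS ⟨_, h2⟩
    by_contra hc
    exact h2 ⟨x, hk, hc⟩
  · convert measure_empty (μ := (volume : Measure (A × Ω → ℝ)))
    ext uS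
    simp only [Set.mem_preimage, Set.mem_sdiff, Set.mem_empty_iff_false, iff_false]
    rintro ⟨h1, _⟩
    exact hex h1

open Classical in
/-- All generic conditions. -/
def Good (μ₀ : Ω → ℝ) (e : (A × Ω → ℝ) × (A × Ω → ℝ)) : Prop :=
  (∀ a0 a1 : A, a0 ≠ a1 → ∀ C S, Gen1 e.1 e.2 a0 a1 C S) ∧
  (∀ a0 a1 : A, a0 ≠ a1 → ∀ ω, e.1 (a1, ω) ≠ e.1 (a0, ω)) ∧
  (∀ a0 a1 : A, a0 ≠ a1 → ∀ S : Finset Ω, S.Nonempty →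
    ∑ ω, (if ω ∈ S then μ₀ ω else 0) * (e.2 (a1, ω) - e.2 (a0, ω)) ≠ 0)

open Classical in
lemma ae_Good {μ₀ : Ω → ℝ} (hμ : IsPrior μ₀) :
    ∀ᵐ e : (A × Ω → ℝ) × (A × Ω → ℝ), Good μ₀ e := by
  unfold Good
  refine Filter.Eventually.and ?_ (Filter.Eventually.and ?_ ?_)
  · simp only [Filter.eventually_all]
    intro a0 a1 hne C S
    exact ae_Gen1 hne C S
  · simp only [ae_all_iff]
    intro a0 a1 hne ω
    have h := null_diff (A := A) hne (x := Pi.single ω (1:ℝ)) (by simp)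
    have h2 := (Measure.quasiMeasurePreserving_fst (μ := (volume : Measure (A × Ω → ℝ)))
      (ν := (volume : Measure (A × Ω → ℝ)))).preimage_null h
    rw [ae_iff]
    refine measure_mono_null ?_ h2
    intro e he
    simp only [Set.mem_ofPred_eq, ne_eq, not_not] at he
    simp [Pi.single_apply, he]
  · simp only [ae_all_iff]
    intro a0 a1 hne S hS
    have h := null_diff (A := A) hne (x := fun ω => if ω ∈ S then μ₀ ω else 0) (by
      obtain ⟨ω, hω⟩ := hS
      intro h0
      have := congrFun h0 ω
      simp [hω, (hμ.1 ω).ne'] at this)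
    have h2 := (Measure.quasiMeasurePreserving_snd (μ := (volume : Measure (A × Ω → ℝ)))
      (ν := (volume : Measure (A × Ω → ℝ)))).preimage_null h
    rw [ae_iff]
    refine measure_mono_null ?_ h2
    intro e he
    simpa using he

/-! ### Main steps -/

lemma strict_obey {μ₀ : Ω → ℝ} {uR : A × Ω → ℝ} {σ : Ω → M → ℝ}
    {ρ : M → A → ℝ} (h : PersProfile μ₀ uR σ ρ) {m : M} {a b : A} (ha : 0 < ρ m a)
    (hlt : ∑ ω, μ₀ ω * σ ω m * uR (b, ω) < ∑ ω, μ₀ ω * σ ω m * uR (a, ω)) :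
    ∑ ω, (∑ m, μ₀ ω * σ ω m * ρ m a) * uR (b, ω) <
      ∑ ω, (∑ m, μ₀ ω * σ ω m * ρ m a) * uR (a, ω) := by
  obtain ⟨hσ, hρ, hR⟩ := h
  rw [RBR_iff _ _ _ _ hρ] at hR
  have e : ∀ c, ∑ ω, (∑ m, μ₀ ω * σ ω m * ρ m a) * uR (c, ω)
      = ∑ m, ρ m a * ∑ ω, μ₀ ω * σ ω m * uR (c, ω) := by
    intro c
    simp only [Finset.sum_mul, Finset.mul_sum]
    rw [Finset.sum_comm]
    exact Finset.sum_congr rfl fun m _ => Finset.sum_congr rfl fun ω _ => by ring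
  rw [e, e]
  refine Finset.sum_lt_sum (fun m _ => ?_) ⟨m, Finset.mem_univ _, mul_lt_mul_of_pos_left hlt ha⟩
  rcases ((hρ m).1 a).eq_or_lt with h0 | h0
  · rw [← h0]; simp
  · exact mul_le_mul_of_nonneg_left (hR m a h0 b) h0.le

lemma pi_pos {μ₀ : Ω → ℝ} (hμ : IsPrior μ₀) {σ : Ω → M → ℝ} {ρ : M → A → ℝ}
    (hσ : IsMsg σ) (hρ : IsAct ρ) {ω : Ω} {m : M} {a : A} (h1 : 0 < σ ω m) (h2 : 0 < ρ m a) :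
    0 < ∑ m, μ₀ ω * σ ω m * ρ m a := by
  refine Finset.sum_pos' (fun m _ => ?_) ⟨m, Finset.mem_univ _, ?_⟩
  · exact mul_nonneg (mul_nonneg (hμ.1 ω).le ((hσ ω).1 m)) ((hρ m).1 a)
  · exact mul_pos (mul_pos (hμ.1 ω) h1) h2

lemma opt_pi [Nonempty A] [Nonempty M] (hM : Fintype.card A < Fintype.card M)
    {μ₀ : Ω → ℝ} (hμ : IsPrior μ₀) {uS uR : A × Ω → ℝ} {σ : Ω → M → ℝ} {ρ : M → A → ℝ}
    (hopt : U μ₀ uS σ ρ = persPayoff (M := M) μ₀ uS uR) (π' : A → Ω → ℝ) (h : Obed μ₀ uR π') :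
    ∑ a, ∑ ω, π' a ω * uS (a, ω) ≤
      ∑ a, ∑ ω, (fun a ω => ∑ m, μ₀ ω * σ ω m * ρ m a) a ω * uS (a, ω) := by
  obtain ⟨σ', ρ', hp, hU, _⟩ := h.exists_profile (M := M) hM hμ
  rw [← hU uS]
  refine (le_pers hp).trans ?_
  rw [← hopt, U_eq_pi]

open Classical in
/-- Generically, Receiver does not mix on path in an optimal persuasion profile. -/
lemma no_mix [Nonempty A] [Nonempty M] (hM : Fintype.card A < Fintype.card M)
    {μ₀ : Ω → ℝ} (hμ : IsPrior μ₀) {e : (A × Ω → ℝ) × (A × Ω → ℝ)} (hG : Good μ₀ e)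
    {σ : Ω → M → ℝ} {ρ : M → A → ℝ} (h : PersProfile μ₀ e.2 σ ρ)
    (hopt : U μ₀ e.1 σ ρ = persPayoff (M := M) μ₀ e.1 e.2) {m : M} (hm : OnPath σ m)
    {a0 a1 : A} (h0 : 0 < ρ m a0) (h1 : 0 < ρ m a1) : a0 = a1 := by
  by_contra hne
  obtain ⟨ω0, hω0⟩ := hm
  have hR := (RBR_iff _ _ _ _ h.2.1).1 h.2.2
  set V : A → ℝ := fun b => ∑ ω, μ₀ ω * σ ω m * e.2 (b, ω) with hV
  have hV0 : ∀ b, V b ≤ V a0 := hR m a0 h0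
  have hV1 : ∀ b, V b ≤ V a1 := hR m a1 h1
  have hV01 : V a1 = V a0 := le_antisymm (hV0 _) (hV1 _)
  obtain ⟨x, hk, hx⟩ := hG.1 a0 a1 hne (Finset.univ.filter fun b => V b = V a0)
    (Finset.univ.filter fun ω => 0 < σ ω m) (by
      refine ⟨fun ω => μ₀ ω * σ ω m, ?_, ?_, ?_⟩
      · intro hc
        have := congrFun hc ω0
        exact (mul_pos (hμ.1 ω0) hω0).ne' this
      · intro ω hω
        have : σ ω m = 0 := by
          simp only [Finset.mem_filter, Finset.mem_univ, true_and, not_lt] at hω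
          exact le_antisymm hω ((h.1 ω).1 m)
        simp [this]
      · intro b hb
        simp only [Finset.mem_filter, Finset.mem_univ, true_and] at hb
        simp only [mul_sub, Finset.sum_sub_distrib]
        exact sub_eq_zero.2 hb)
  have main : ∀ y, Ker e.2 a0 (Finset.univ.filter fun b => V b = V a0)
      (Finset.univ.filter fun ω => 0 < σ ω m) y →
      ∑ ω, y ω * e.1 (a1, ω) ≤ ∑ ω, y ω * e.1 (a0, ω) := by
    intro y hy
    have hC : ∀ b, V b = V a0 → ∑ ω, y ω * e.2 (b, ω) = ∑ ω, y ω * e.2 (a0, ω) := by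
      intro b hb
      have := hy.2 b (by simpa using hb)
      simp only [mul_sub, Finset.sum_sub_distrib] at this
      linarith
    have hS : ∀ ω, y ω ≠ 0 → 0 < σ ω m := by
      intro ω hne
      by_contra hc
      exact hne (hy.1 ω (by simpa using hc))
    refine perturb (h.obed hμ) (opt_pi hM hμ hopt) hne y ?_ ?_ ?_ ?_
    · intro ω hω
      exact pi_pos hμ h.1 h.2.1 (hS ω hω.ne') h0
    · intro ω hω
      exact pi_pos hμ h.1 h.2.1 (hS ω hω.ne) h1
    · intro b
      rcases (hV0 b).eq_or_lt with hb | hb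
      · right; rw [hC b hb, hC a1 hV01]
      · left; exact strict_obey h h1 (by rw [← hV01] at hb; exact hb)
    · intro b
      rcases (hV0 b).eq_or_lt with hb | hb
      · right; rw [hC b hb]
      · left; exact strict_obey h h0 hb
  have m1 := main x hk
  have m2 := main ((-1 : ℝ) • x) (hk.smul _)
  simp only [Pi.smul_apply, smul_eq_mul, neg_mul, one_mul, Finset.sum_neg_distrib] at m2
  apply hx
  simp only [mul_sub, Finset.sum_sub_distrib]
  linarith

open Classical in
/-- If commitment has no value, a partitional profile attains the persuasion payoff. -/
lemma step12 [Nonempty A] [Nonempty M] (hM : Fintype.card A < Fintype.card M)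
    {μ₀ : Ω → ℝ} (hμ : IsPrior μ₀) {e : (A × Ω → ℝ) × (A × Ω → ℝ)} (hG : Good μ₀ e)
    (hct : persPayoff (M := M) μ₀ e.1 e.2 ≤ ctPayoff (M := M) μ₀ e.1 e.2) :
    persPayoff (M := M) μ₀ e.1 e.2 ≤ partPersPayoff (M := M) μ₀ e.1 e.2 := by
  obtain ⟨σ, ρ, hCT, hU⟩ := exists_ct (M := M) (uS := e.1) (uR := e.2) hμ
  have hp : PersProfile μ₀ e.2 σ ρ := ⟨hCT.1, hCT.2.1, hCT.2.2.2⟩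
  have hopt : U μ₀ e.1 σ ρ = persPayoff (M := M) μ₀ e.1 e.2 :=
    le_antisymm (le_pers hp) (hU ▸ hct)
  have hS := (SBR_iff _ hμ _ _ _ hCT.1).1 hCT.2.2.1
  choose μ hμpos using fun ω => (hCT.1 ω).exists_pos
  choose α hα using fun m => (hCT.2.1 m).exists_pos
  have hpure : ∀ m, OnPath σ m → ∀ a, ρ m a = if a = α m then 1 else 0 := fun m hm =>
    (hCT.2.1 m).eq_single fun a ha => no_mix hM hμ hG hp hopt hm ha (hα m)
  have hval : ∀ m, OnPath σ m → ∀ ω, ∑ a, ρ m a * e.1 (a, ω) = e.1 (α m, ω) := by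
    intro m hm ω
    simp [hpure m hm]
  have hsame : ∀ ω m, 0 < σ ω m → α m = α (μ ω) := by
    intro ω m hm
    by_contra hne
    refine hG.2.1 _ _ hne ω ?_
    rw [← hval m ⟨ω, hm⟩, ← hval (μ ω) ⟨ω, hμpos ω⟩]
    exact le_antisymm (hS ω m hm _) (hS ω _ (hμpos ω) _)
  have hpi : ∀ a ω, ∑ m, μ₀ ω * σ ω m * ρ m a = if a = α (μ ω) then μ₀ ω else 0 := by
    intro a ω
    have : ∀ m, μ₀ ω * σ ω m * ρ m a = σ ω m * (if a = α (μ ω) then μ₀ ω else 0) := by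
      intro m
      rcases ((hCT.1 ω).1 m).eq_or_lt with hz | hz
      · rw [← hz]; ring
      · rw [hpure m ⟨ω, hz⟩, hsame ω m hz]
        split_ifs <;> ring
    rw [Finset.sum_congr rfl fun m _ => this m, ← Finset.sum_mul, (hCT.1 ω).2, one_mul]
  obtain ⟨σ', ρ', hp', hU', hm'⟩ := (hp.obed hμ).exists_profile (M := M) hM hμ
  have hpart : Partitional σ' := by
    intro ω
    obtain ⟨m, hm⟩ := hm' (α (μ ω))
    refine ⟨m, ?_⟩
    rw [hm ω, hpi]
    simp [(hμ.1 ω).ne']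
  have := le_part (uS := e.1) hpart hp'
  rw [hU' e.1, ← U_eq_pi, hopt] at this
  exact this

lemma post_iff {μ₀ : Ω → ℝ} (hμ : IsPrior μ₀) {uR : A × Ω → ℝ} {σ : Ω → M → ℝ} (hσ : IsMsg σ)
    {m : M} (hm : OnPath σ m) (a b : A) :
    ∑ ω, post μ₀ σ m ω * uR (b, ω) ≤ ∑ ω, post μ₀ σ m ω * uR (a, ω) ↔
      ∑ ω, μ₀ ω * σ ω m * uR (b, ω) ≤ ∑ ω, μ₀ ω * σ ω m * uR (a, ω) := by
  have hpos : 0 < ∑ ω', μ₀ ω' * σ ω' m := by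
    obtain ⟨ω, hω⟩ := hm
    exact Finset.sum_pos' (fun ω _ => mul_nonneg (hμ.1 ω).le ((hσ ω).1 m))
      ⟨ω, Finset.mem_univ _, mul_pos (hμ.1 ω) hω⟩
  have e : ∀ c, ∑ ω, post μ₀ σ m ω * uR (c, ω)
      = (∑ ω, μ₀ ω * σ ω m * uR (c, ω)) / ∑ ω', μ₀ ω' * σ ω' m := by
    intro c
    rw [Finset.sum_div]
    exact Finset.sum_congr rfl fun ω _ => by unfold post; ring
  rw [e, e, div_le_div_iff_of_pos_right hpos]

/-- Unique best responses on path. -/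
def Uniq (μ₀ : Ω → ℝ) (uR : A × Ω → ℝ) (σ : Ω → M → ℝ) : Prop :=
  ∀ m, OnPath σ m → ∀ a a',
    (∀ b, ∑ ω, μ₀ ω * σ ω m * uR (b, ω) ≤ ∑ ω, μ₀ ω * σ ω m * uR (a, ω)) →
    (∀ b, ∑ ω, μ₀ ω * σ ω m * uR (b, ω) ≤ ∑ ω, μ₀ ω * σ ω m * uR (a', ω)) → a = a'

open Classical in
lemma step23 [Nonempty A] [Nonempty M]
    {μ₀ : Ω → ℝ} (hμ : IsPrior μ₀) {e : (A × Ω → ℝ) × (A × Ω → ℝ)} (hG : Good μ₀ e)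
    (hpart : persPayoff (M := M) μ₀ e.1 e.2 ≤ partPersPayoff (M := M) μ₀ e.1 e.2) :
    ∃ (σ : Ω → M → ℝ) (ρ : M → A → ℝ), PersProfile μ₀ e.2 σ ρ ∧
      U μ₀ e.1 σ ρ = persPayoff (M := M) μ₀ e.1 e.2 ∧ Uniq μ₀ e.2 σ := by
  obtain ⟨σ, ρ, hP, hp, hU⟩ := exists_part (M := M) (uS := e.1) (uR := e.2) hμ
  refine ⟨σ, ρ, hp, le_antisymm (le_pers hp) (hU ▸ hpart), ?_⟩
  intro m hm a a' ha ha'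
  by_contra hne
  have h01 : ∀ ω, μ₀ ω * σ ω m =
      if ω ∈ Finset.univ.filter (fun ω => 0 < σ ω m) then μ₀ ω else 0 := by
    intro ω
    obtain ⟨m1, hm1⟩ := hP ω
    have hs := (hp.1 ω).eq_single (x := m1) (by
      intro y hy
      by_contra hyne
      have h2 := (hp.1 ω).2
      rw [← Finset.add_sum_erase _ _ (Finset.mem_univ m1), hm1] at h2
      have h3 : σ ω y ≤ ∑ x ∈ Finset.univ.erase m1, σ ω x :=
        Finset.single_le_sum (fun z _ => (hp.1 ω).1 z)
          (Finset.mem_erase.2 ⟨hyne, Finset.mem_univ y⟩)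
      linarith)
    simp only [Finset.mem_filter, Finset.mem_univ, true_and]
    rw [hs m]
    split_ifs <;> simp_all
  refine hG.2.2 a a' hne (Finset.univ.filter fun ω => 0 < σ ω m) ?_ ?_
  · obtain ⟨ω, hω⟩ := hm
    exact ⟨ω, by simpa using hω⟩
  · simp only [← h01, mul_sub, Finset.sum_sub_distrib]
    exact sub_eq_zero.2 (le_antisymm (ha a') (ha' a))

open Classical in
lemma step31 [Nonempty Ω] [Nonempty A] [Nonempty M] (hM : Fintype.card A < Fintype.card M)
    {μ₀ : Ω → ℝ} (hμ : IsPrior μ₀) {uS uR : A × Ω → ℝ}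
    {σ : Ω → M → ℝ} {ρ : M → A → ℝ} (hp : PersProfile μ₀ uR σ ρ)
    (hopt : U μ₀ uS σ ρ = persPayoff (M := M) μ₀ uS uR) (hu : Uniq μ₀ uR σ) :
    persPayoff (M := M) μ₀ uS uR ≤ ctPayoff (M := M) μ₀ uS uR := by
  have hR := (RBR_iff _ _ _ _ hp.2.1).1 hp.2.2
  choose α hα using fun m => (hp.2.1 m).exists_pos
  have hpure : ∀ m, OnPath σ m → ∀ a, ρ m a = if a = α m then 1 else 0 := fun m hm =>
    (hp.2.1 m).eq_single fun a ha => hu m hm a _ (hR m a ha) (hR m _ (hα m))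
  have hval : ∀ m, OnPath σ m → ∀ ω, ∑ a, ρ m a * uS (a, ω) = uS (α m, ω) := by
    intro m hm ω
    simp [hpure m hm]
  have hstrict : ∀ m, OnPath σ m → ∀ b, b ≠ α m →
      ∑ ω, (∑ m', μ₀ ω * σ ω m' * ρ m' (α m)) * uR (b, ω) <
      ∑ ω, (∑ m', μ₀ ω * σ ω m' * ρ m' (α m)) * uR (α m, ω) := by
    intro m hm b hb
    refine strict_obey hp (hα m) (lt_of_le_of_ne (hR m _ (hα m) b) ?_)
    intro heq
    refine hb (hu m hm b _ ?_ (hR m _ (hα m)))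
    intro c
    rw [heq]
    exact hR m _ (hα m) c
  obtain ⟨ω0⟩ := ‹Nonempty Ω›
  obtain ⟨m0, hm0⟩ := (hp.1 ω0).exists_pos
  let r : M → M := fun m => if OnPath σ m then m else m0
  have hr : ∀ m, OnPath σ m → r m = m := fun m hm => if_pos hm
  have hrp : ∀ m, OnPath σ (r m) := by
    intro m
    by_cases hm : OnPath σ m
    · rw [hr m hm]; exact hm
    · simp only [r, hm, if_false]; exact ⟨ω0, hm0⟩
  have hρ' : IsAct (fun m => ρ (r m)) := fun m => hp.2.1 (r m)
  have hCT : CTEq μ₀ uS uR σ (fun m => ρ (r m)) := by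
    refine ⟨hp.1, hρ', ?_, ?_⟩
    · rw [SBR_iff _ hμ _ _ _ hp.1]
      intro ω m hm m'
      have hm1 : OnPath σ m := ⟨ω, hm⟩
      rw [hr m hm1, hval _ (hrp m'), hval _ hm1]
      by_cases hne : α m = α (r m')
      · rw [hne]
      have key := perturb (uS := uS) (hp.obed hμ) (opt_pi hM hμ hopt) hne (Pi.single ω 1) ?_ ?_ ?_ ?_
      · simpa [Pi.single_apply] using key
      · intro ω' h'
        have : ω' = ω := by
          by_contra hc
          simp [hc] at h'
        subst this
        exact pi_pos hμ hp.1 hp.2.1 hm (hα m)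
      · intro ω' h'
        exfalso
        rw [Pi.single_apply] at h'
        split_ifs at h' <;> linarith
      · intro b
        by_cases hb : b = α (r m')
        · right; rw [hb]
        · left; exact hstrict _ (hrp m') b hb
      · intro b
        by_cases hb : b = α m
        · right; rw [hb]
        · left; exact hstrict _ hm1 b hb
    · rw [RBR_iff _ _ _ _ hρ']
      intro m a ha b
      by_cases hm : OnPath σ m
      · rw [hr m hm] at ha
        exact hR m a ha b
      · have : ∀ ω, σ ω m = 0 := fun ω =>
          le_antisymm (not_lt.1 fun h => hm ⟨ω, h⟩) ((hp.1 ω).1 m)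
        simp [this]
  have hU : U μ₀ uS σ (fun m => ρ (r m)) = U μ₀ uS σ ρ := by
    rw [U_eq_S, U_eq_S]
    refine Finset.sum_congr rfl fun ω _ => Finset.sum_congr rfl fun m _ => ?_
    rcases ((hp.1 ω).1 m).eq_or_lt with hz | hz
    · rw [← hz]; ring
    · rw [hr m ⟨ω, hz⟩]
  rw [← hopt, ← hU]
  exact le_ct hCT

/-- Theorem 1′ (Kamenica–Lin): generically, the following are equivalent:
(1) commitment is valuable, (2) committed Sender values randomization, (3) every
optimal persuasion profile has an on-path message at which Receiver's argmax
contains at least two actions. -/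
theorem threefold_equivalence
    (Ω A M : Type) [Fintype Ω] [Fintype A] [Fintype M]
    [Nonempty Ω] [Nonempty A]
    (hM : max (Fintype.card Ω) (Fintype.card A) < Fintype.card M)
    (μ₀ : Ω → ℝ) (hμ : IsPrior μ₀) :
    ∃ G : Set ((A × Ω → ℝ) × (A × Ω → ℝ)),
      G ⊆ EnvCube Ω A ∧
      volume (EnvCube Ω A \ G) = 0 ∧
      ∀ e ∈ G,
        (ctPayoff (M := M) μ₀ e.1 e.2 < persPayoff (M := M) μ₀ e.1 e.2 ↔
          partPersPayoff (M := M) μ₀ e.1 e.2 < persPayoff (M := M) μ₀ e.1 e.2) ∧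
        (ctPayoff (M := M) μ₀ e.1 e.2 < persPayoff (M := M) μ₀ e.1 e.2 ↔
          ∀ (σ : Ω → M → ℝ) (ρ : M → A → ℝ),
            PersProfile μ₀ e.2 σ ρ →
            U μ₀ e.1 σ ρ = persPayoff (M := M) μ₀ e.1 e.2 →
            ∃ m : M, OnPath σ m ∧
              ∃ a a' : A, a ≠ a' ∧
                (∀ b : A, ∑ ω, post μ₀ σ m ω * e.2 (b, ω) ≤
                  ∑ ω, post μ₀ σ m ω * e.2 (a, ω)) ∧
                (∀ b : A, ∑ ω, post μ₀ σ m ω * e.2 (b, ω) ≤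
                  ∑ ω, post μ₀ σ m ω * e.2 (a', ω))) := by
  have hMA : Fintype.card A < Fintype.card M := lt_of_le_of_lt (le_max_right _ _) hM
  have : Nonempty M := Fintype.card_pos_iff.1 (lt_of_le_of_lt (Nat.zero_le _) hMA)
  refine ⟨EnvCube Ω A ∩ {e | Good μ₀ e}, Set.inter_subset_left, ?_, ?_⟩
  · refine measure_mono_null ?_ (ae_iff.1 (ae_Good (A := A) hμ))
    rintro e ⟨h1, h2⟩ h3
    exact h2 ⟨h1, h3⟩
  rintro e ⟨-, hG⟩
  have hG : Good μ₀ e := hG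
  have s12 := step12 (M := M) hMA hμ hG
  have s23 := step23 (M := M) hμ hG
  have s31 : ∀ (σ : Ω → M → ℝ) (ρ : M → A → ℝ), _ := fun σ ρ =>
    step31 (M := M) (uS := e.1) (uR := e.2) (σ := σ) (ρ := ρ) hMA hμ
  constructor
  · rw [← not_le, ← not_le, not_iff_not]
    refine ⟨s12, fun h => ?_⟩
    obtain ⟨σ, ρ, hp, hopt, hu⟩ := s23 h
    exact s31 σ ρ hp hopt hu
  · constructor
    · intro hlt σ ρ hp hopt
      by_contra hc
      refine absurd (s31 σ ρ hp hopt ?_) (not_le.2 hlt)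
      intro m hm a a' ha ha'
      by_contra hne
      exact hc ⟨m, hm, a, a', hne, fun b => (post_iff hμ hp.1 hm a b).2 (ha b),
        fun b => (post_iff hμ hp.1 hm a' b).2 (ha' b)⟩
    · intro h
      by_contra hle
      obtain ⟨σ, ρ, hp, hopt, hu⟩ := s23 (s12 (not_lt.1 hle))
      obtain ⟨m, hm, a, a', hne, ha, ha'⟩ := h σ ρ hp hopt
      exact hne (hu m hm a a' (fun b => (post_iff hμ hp.1 hm a b).1 (ha b))
        (fun b => (post_iff hμ hp.1 hm a' b).1 (ha' b)))

end KL
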